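/- arXiv:2011.01418 — 5 statements merged into one kernel-verified Lean document; each statement's English description precedes it below -/
import Mathlib

section
/- Let d ≥ 2, m ≥ 1 and let j be an integer with 2 ≤ j ≤ d. If φ = [w_1, …, w_m] ∈ ℝ^{d×m} is such that every column w_i is a scalar multiple (possibly zero) of e_j, then for every head θ_t ∈ ℝ^m one has L_{D_t}(θ_t, φ) ≥ 10/27. -/
open MeasureTheory Finset

noncomputable section

/-- Uniform measure on `{-1, 0, 1} ⊆ ℝ`. -/
def unif3 : Measure ℝ :=
  (PMF.uniformOfFinset ({-1, 0, 1} : Finset ℝ) (by norm_num)).toMeasure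

/-- Uniform measure on `{-1, 1} ⊆ ℝ`. -/
def unif2 : Measure ℝ :=
  (PMF.uniformOfFinset ({-1, 1} : Finset ℝ) (by norm_num)).toMeasure

/-- Distribution of `x` conditioned on `y = 0` under the source distribution `D_s^(k)`. -/
def srcBranch0 (d k : ℕ) : Measure (Fin d → ℝ) :=
  Measure.pi (fun i => if (i : ℕ) < k then Measure.dirac (0 : ℝ) else unif3)

/-- Distribution of `x` conditioned on `y = 1` under the source distribution `D_s^(k)`. -/
def srcBranch1 (d k : ℕ) : Measure (Fin d → ℝ) :=
  Measure.pi (fun i => if (i : ℕ) < k then unif2 else unif3)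

/-- The source distribution `D_s^(k)` on `ℝ^d × ℝ`. -/
def sourceMeasure (d k : ℕ) : Measure ((Fin d → ℝ) × ℝ) :=
  (1/3 : ENNReal) • (srcBranch0 d k).map (fun x => (x, (0 : ℝ)))
    + (2/3 : ENNReal) • (srcBranch1 d k).map (fun x => (x, (1 : ℝ)))

/-- The target distribution `D_t = D_s^(1)`. -/
def targetMeasure (d : ℕ) : Measure ((Fin d → ℝ) × ℝ) := sourceMeasure d 1

/-- The two-layer quadratic network `f_{θ,φ}(x) = ∑ i, θ i (w_i ⬝ x)^2`,
where `w_i` is the `i`-th column of `φ`. -/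
def qnet {d m : ℕ} (θ : Fin m → ℝ) (φ : Matrix (Fin d) (Fin m) ℝ) (x : Fin d → ℝ) : ℝ :=
  ∑ i, θ i * (∑ j, φ j i * x j) ^ 2

/-- Population squared loss on the distribution `D`. -/
def popLoss {d m : ℕ} (D : Measure ((Fin d → ℝ) × ℝ)) (θ : Fin m → ℝ)
    (φ : Matrix (Fin d) (Fin m) ℝ) : ℝ :=
  ∫ p, (qnet θ φ p.1 - p.2) ^ 2 ∂D

/-- Empirical squared loss on the dataset `S`. -/
def empLoss {d m n : ℕ} (S : Fin n → (Fin d → ℝ) × ℝ) (θ : Fin m → ℝ)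
    (φ : Matrix (Fin d) (Fin m) ℝ) : ℝ :=
  (1 / (n : ℝ)) * ∑ i, (qnet θ φ (S i).1 - (S i).2) ^ 2

/-- Squared Frobenius norm of the feature extractor. -/
def frobSq {d m : ℕ} (φ : Matrix (Fin d) (Fin m) ℝ) : ℝ := ∑ j, ∑ i, (φ j i) ^ 2

/-- Squared Euclidean norm of a head. -/
def normSq {m : ℕ} (θ : Fin m → ℝ) : ℝ := ∑ i, (θ i) ^ 2

/-- The regularized joint training objective `L_joint^λ`. -/
def jointObj {d m n : ℕ} (k : ℕ) (α lam : ℝ) (S : Fin n → (Fin d → ℝ) × ℝ)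
    (θs θt : Fin m → ℝ) (φ : Matrix (Fin d) (Fin m) ℝ) : ℝ :=
  (1 - α) * popLoss (sourceMeasure d k) θs φ + α * empLoss S θt φ
    + lam * (normSq θs + normSq θt + frobSq φ)

end

instance unif3_prob : IsProbabilityMeasure unif3 := by
  unfold unif3; infer_instance

instance unif2_prob : IsProbabilityMeasure unif2 := by
  unfold unif2; infer_instance

theorem unif3_eq : unif3 = (3 : ENNReal)⁻¹ •
    (Measure.dirac (-1 : ℝ) + Measure.dirac (0 : ℝ) + Measure.dirac (1 : ℝ)) := by
  classical
  ext t ht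
  unfold unif3
  rw [PMF.toMeasure_uniformOfFinset_apply _ _ ht]
  have hc : ({-1, 0, 1} : Finset ℝ).card = 3 := by
    rw [Finset.card_eq_three]
    exact ⟨-1, 0, 1, by norm_num, by norm_num, by norm_num, rfl⟩
  rw [hc, Finset.card_filter, Finset.sum_insert (by norm_num), Finset.sum_insert (by norm_num),
    Finset.sum_singleton]
  simp only [Measure.smul_apply, Measure.add_apply, Measure.dirac_apply' _ ht, Set.indicator_apply,
    Pi.one_apply, smul_eq_mul, div_eq_mul_inv]
  push_cast
  rw [mul_comm, add_assoc]

theorem integrable_unif3 (g : ℝ → ℝ) : Integrable g unif3 := by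
  rw [unif3_eq]
  refine Integrable.smul_measure ?_ (by simp)
  refine ((integrable_dirac ?_).add_measure (integrable_dirac ?_)).add_measure
    (integrable_dirac ?_) <;> simp

theorem integral_unif3 (g : ℝ → ℝ) : ∫ x, g x ∂unif3 = (g (-1) + g 0 + g 1) / 3 := by
  have h : ∀ a : ℝ, Integrable g (Measure.dirac a) := fun a => integrable_dirac (by simp)
  rw [unif3_eq, integral_smul_measure,
    integral_add_measure ((h _).add_measure (h _)) (h _),
    integral_add_measure (h _) (h _)]
  simp
  ring

theorem branch_aux {d : ℕ} (μ : Fin d → Measure ℝ) [∀ i, IsProbabilityMeasure (μ i)] (j : Fin d)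
    (hj : μ j = unif3) (y : ℝ) (F : (Fin d → ℝ) × ℝ → ℝ) (hF : Measurable F) (g : ℝ → ℝ)
    (hg : Measurable g) (hFg : ∀ x, F (x, y) = g (x j)) :
    Integrable F ((Measure.pi μ).map (fun x => (x, y))) ∧
    ∫ p, F p ∂((Measure.pi μ).map (fun x => (x, y))) = (g (-1) + g 0 + g 1) / 3 := by
  have hm : Measurable (fun x : Fin d → ℝ => (x, y)) := by fun_prop
  have hp := measurePreserving_eval μ j
  rw [hj] at hp
  constructor
  · rw [integrable_map_measure hF.aestronglyMeasurable hm.aemeasurable]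
    have : F ∘ (fun x : Fin d → ℝ => (x, y)) = g ∘ Function.eval j := by
      ext x; exact hFg x
    rw [this]
    exact hp.integrable_comp_of_integrable (integrable_unif3 g)
  · rw [integral_map hm.aemeasurable hF.aestronglyMeasurable]
    simp only [hFg]
    rw [← integral_unif3 g, ← hp.map_eq,
      integral_map hp.measurable.aemeasurable hg.aestronglyMeasurable]

/-- Theorem 1 (fine-tuning part): if every column of the feature extractor `φ` is a scalar
multiple of a source-specific direction `e_j` with `2 ≤ j`, then no target head can achieve
target population loss below `10/27`. (Indices of coordinates are `0`-based: the Fin index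
`j` with `1 ≤ (j : ℕ)` corresponds to the paper's coordinate `j ∈ {2, …, d}`.) -/
theorem finetuning_fails (d m : ℕ) (hd : 2 ≤ d) (j : Fin d) (hj : 1 ≤ (j : ℕ))
    (φ : Matrix (Fin d) (Fin m) ℝ)
    (hφ : ∀ i : Fin m, ∃ c : ℝ, ∀ l : Fin d, φ l i = c * (if l = j then 1 else 0)) :
    ∀ θt : Fin m → ℝ, 10 / 27 ≤ popLoss (targetMeasure d) θt φ := by
  intro θ
  choose c hc using hφ
  obtain ⟨a, ha⟩ : ∃ a : ℝ, ∀ x, qnet θ φ x = a * (x j) ^ 2 := by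
    refine ⟨∑ i, θ i * (c i) ^ 2, fun x => ?_⟩
    unfold qnet
    rw [Finset.sum_mul]
    refine Finset.sum_congr rfl fun i _ => ?_
    have : ∑ l, φ l i * x l = c i * x j := by
      simp [hc]
    rw [this]; ring
  have hF : Measurable (fun p : (Fin d → ℝ) × ℝ => (qnet θ φ p.1 - p.2) ^ 2) := by
    simp only [ha]; fun_prop
  have hj' : ¬ (j : ℕ) < 1 := by omega
  have i0 : ∀ i : Fin d, IsProbabilityMeasure
      (if (i : ℕ) < 1 then Measure.dirac (0 : ℝ) else unif3) := by
    intro i; split_ifs <;> infer_instance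
  have i1 : ∀ i : Fin d, IsProbabilityMeasure
      (if (i : ℕ) < 1 then unif2 else unif3) := by
    intro i; split_ifs <;> infer_instance
  obtain ⟨I0, E0⟩ := branch_aux
    (fun i : Fin d => if (i : ℕ) < 1 then Measure.dirac (0 : ℝ) else unif3) j
    (by simp only [hj', if_false]) 0 _ hF (fun t => (a * t ^ 2 - 0) ^ 2) (by fun_prop)
    (by intro x; simp only [ha])
  obtain ⟨I1, E1⟩ := branch_aux
    (fun i : Fin d => if (i : ℕ) < 1 then unif2 else unif3) j
    (by simp only [hj', if_false]) 1 _ hF (fun t => (a * t ^ 2 - 1) ^ 2) (by fun_prop)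
    (by intro x; simp only [ha])
  unfold popLoss targetMeasure sourceMeasure srcBranch0 srcBranch1
  rw [integral_add_measure (I0.smul_measure (by finiteness)) (I1.smul_measure (by finiteness)),
    integral_smul_measure, integral_smul_measure, E0, E1]
  simp only [ENNReal.toReal_div, ENNReal.toReal_one, ENNReal.toReal_ofNat, smul_eq_mul]
  nlinarith [sq_nonneg (a - 2 / 3)]
end

section
/- There is a universal constant C > 0 such that the following holds. Let 2 ≤ k ≤ d, m ≥ 1, 0 < λ < 0.1, ρ > 0 and ξ ∈ (0,1), and let n_t be an even integer with n_t ≥ C·log(k/ξ). Draw n_t i.i.d. samples from D_t and let D̂_t^tr and D̂_t^val be the first and second halves of the sample. Define the meta objective L_meta(θ_s, φ) = L_{D_s^{(k)}}(θ_s, φ) + λ(‖θ_s‖^2 + ‖φ‖_F^2) + ρ·inf{ L_{D̂_t^val}(θ_t, φ) : θ_t ∈ argmin_θ L_{D̂_t^tr}(θ, φ) }. Then with probability at least 1 − ξ over the sample: every global minimizer (θ̂_s, φ̂) of L_meta has exactly one nonzero column of φ̂, which is a nonzero scalar multiple of e_1; and for every such minimizer, every θ̂_t ∈ argmin_θ L_{D̂_t^tr}(θ,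 φ̂) satisfies L_{D_t}(θ̂_t, φ̂) = 0, i.e., the learned model recovers the target ground truth. -/
open MeasureTheory Finset

noncomputable section

/-- The regularized MeRLin (meta representation learning) objective: source loss plus
`ℓ2` regularization plus `ρ` times the validation loss of a head fitted on the
target training split. -/
def metaObj {d m n : ℕ} (k : ℕ) (lam ρ : ℝ) (Str Sval : Fin n → (Fin d → ℝ) × ℝ)
    (θs : Fin m → ℝ) (φ : Matrix (Fin d) (Fin m) ℝ) : ℝ :=
  popLoss (sourceMeasure d k) θs φ + lam * (normSq θs + frobSq φ)
    + ρ * sInf {v : ℝ | ∃ θt : Fin m → ℝ,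
        (∀ θ' : Fin m → ℝ, empLoss Str θt φ ≤ empLoss Str θ' φ) ∧ v = empLoss Sval θt φ}

end


open ProbabilityTheory in
theorem aux_pmf_int (s : Finset ℝ) (hs : s.Nonempty) (f : ℝ → ℝ)
    (hf : Integrable f (PMF.uniformOfFinset s hs).toMeasure) :
    ∫ x, f x ∂(PMF.uniformOfFinset s hs).toMeasure = (s.card : ℝ)⁻¹ * ∑ x ∈ s, f x := by
  rw [PMF.integral_eq_tsum _ _ hf, tsum_eq_sum (s := s), Finset.mul_sum]
  · refine Finset.sum_congr rfl fun x hx => ?_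
    simp [PMF.uniformOfFinset_apply, hx]
  · intro x hx
    simp [PMF.uniformOfFinset_apply, hx]

theorem aux_ae_mem (s : Finset ℝ) (hs : s.Nonempty) :
    ∀ᵐ x ∂(PMF.uniformOfFinset s hs).toMeasure, x ∈ s := by
  rw [ae_iff]
  rw [PMF.toMeasure_apply_eq_zero_iff]
  · rw [PMF.support_uniformOfFinset, Set.disjoint_left]
    intro x hx hx'
    exact hx' hx
  · exact (Finset.measurableSet s).compl

theorem aux_singleton (s : Finset ℝ) (hs : s.Nonempty) (x : ℝ) (hx : x ∈ s) :
    (PMF.uniformOfFinset s hs).toMeasure {x} = (s.card : ENNReal)⁻¹ := by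
  rw [PMF.toMeasure_apply_singleton _ _ (measurableSet_singleton x)]
  simp [PMF.uniformOfFinset_apply, hx]

instance : IsProbabilityMeasure unif3 := by unfold unif3; infer_instance
instance : IsProbabilityMeasure unif2 := by unfold unif2; infer_instance

theorem unif3_ae : ∀ᵐ x ∂unif3, x = -1 ∨ x = 0 ∨ x = 1 := by
  have := aux_ae_mem ({-1, 0, 1} : Finset ℝ) (by norm_num)
  unfold unif3
  filter_upwards [this] with x hx
  simpa using hx

theorem unif2_ae : ∀ᵐ x ∂unif2, x = -1 ∨ x = 1 := by
  have := aux_ae_mem ({-1, 1} : Finset ℝ) (by norm_num)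
  unfold unif2
  filter_upwards [this] with x hx
  simpa using hx

theorem card3 : ({-1, 0, 1} : Finset ℝ).card = 3 := by
  rw [Finset.card_eq_three]; exact ⟨-1, 0, 1, by norm_num, by norm_num, by norm_num, rfl⟩
theorem card2 : ({-1, 1} : Finset ℝ).card = 2 := by
  rw [Finset.card_eq_two]; exact ⟨-1, 1, by norm_num, rfl⟩

theorem unif3_singleton (x : ℝ) (hx : x = -1 ∨ x = 0 ∨ x = 1) : unif3 {x} = 3⁻¹ := by
  unfold unif3
  rw [aux_singleton _ _ _ (by simpa using hx), card3]; norm_num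

theorem unif2_singleton (x : ℝ) (hx : x = -1 ∨ x = 1) : unif2 {x} = 2⁻¹ := by
  unfold unif2
  rw [aux_singleton _ _ _ (by simpa using hx), card2]; norm_num

theorem integrable_of_bdd (μ : Measure ℝ) [IsProbabilityMeasure μ] (h : ∀ᵐ x ∂μ, |x| ≤ 1)
    (f : ℝ → ℝ) (hf : Continuous f) : Integrable f μ := by
  have h1 : IntegrableOn f (Set.Icc (-1) 1) μ := hf.continuousOn.integrableOn_compact isCompact_Icc
  rwa [IntegrableOn, Measure.restrict_eq_self_of_ae_mem] at h1
  filter_upwards [h] with x hx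
  exact abs_le.mp hx

theorem integrable_of_bdd_pi {d : ℕ} (μ : Measure (Fin d → ℝ)) [IsProbabilityMeasure μ]
    (h : ∀ᵐ x ∂μ, ∀ i, |x i| ≤ 1)
    (f : (Fin d → ℝ) → ℝ) (hf : Continuous f) : Integrable f μ := by
  have h1 : IntegrableOn f (Set.Icc (fun _ => -1) (fun _ => 1)) μ :=
    hf.continuousOn.integrableOn_compact isCompact_Icc
  rwa [IntegrableOn, Measure.restrict_eq_self_of_ae_mem] at h1
  filter_upwards [h] with x hx
  exact ⟨fun i => (abs_le.mp (hx i)).1, fun i => (abs_le.mp (hx i)).2⟩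

theorem unif3_bdd : ∀ᵐ x ∂unif3, |x| ≤ 1 := by
  filter_upwards [unif3_ae] with x hx
  rcases hx with h | h | h <;> simp [h]

theorem unif2_bdd : ∀ᵐ x ∂unif2, |x| ≤ 1 := by
  filter_upwards [unif2_ae] with x hx
  rcases hx with h | h <;> simp [h]

theorem unif3_mean : ∫ x, x ∂unif3 = 0 := by
  have h := integrable_of_bdd unif3 unif3_bdd (fun x => x) continuous_id
  unfold unif3 at h ⊢
  rw [aux_pmf_int _ _ _ h, Finset.sum_insert (by norm_num), Finset.sum_insert (by norm_num)]
  simp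

theorem unif2_mean : ∫ x, x ∂unif2 = 0 := by
  have h := integrable_of_bdd unif2 unif2_bdd (fun x => x) continuous_id
  unfold unif2 at h ⊢
  rw [aux_pmf_int _ _ _ h, Finset.sum_insert (by norm_num)]
  simp

instance inst0 (k : ℕ) (d : ℕ) (i : Fin d) : IsProbabilityMeasure
    (if (i : ℕ) < k then Measure.dirac (0 : ℝ) else unif3) := by split_ifs <;> infer_instance
instance inst1 (k : ℕ) (d : ℕ) (i : Fin d) : IsProbabilityMeasure
    (if (i : ℕ) < k then unif2 else unif3) := by split_ifs <;> infer_instance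
instance (d k : ℕ) : IsProbabilityMeasure (srcBranch0 d k) := by unfold srcBranch0; infer_instance
instance (d k : ℕ) : IsProbabilityMeasure (srcBranch1 d k) := by unfold srcBranch1; infer_instance

theorem pi_ae {d : ℕ} (μ : Fin d → Measure ℝ) [∀ i, IsProbabilityMeasure (μ i)] (i : Fin d)
    (P : ℝ → Prop) (h : ∀ᵐ x ∂(μ i), P x) : ∀ᵐ x ∂(Measure.pi μ), P (x i) :=
  (measurePreserving_eval μ i).quasiMeasurePreserving.tendsto_ae.eventually h

theorem br0_bdd (d k : ℕ) : ∀ᵐ x ∂(srcBranch0 d k), ∀ i, |x i| ≤ 1 := by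
  rw [ae_all_iff]; intro i
  refine pi_ae _ i (fun x => |x| ≤ 1) ?_
  split_ifs
  · rw [ae_dirac_iff (measurableSet_le (by fun_prop) (by fun_prop))]; simp
  · exact unif3_bdd

theorem br1_one_bdd (d k : ℕ) (i : Fin d) :
    ∀ᵐ x ∂(if (i : ℕ) < k then unif2 else unif3), |x| ≤ 1 := by
  split_ifs
  · exact unif2_bdd
  · exact unif3_bdd

theorem br1_one_mean (d k : ℕ) (i : Fin d) :
    ∫ x, x ∂(if (i : ℕ) < k then unif2 else unif3) = 0 := by
  split_ifs
  · exact unif2_mean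
  · exact unif3_mean

theorem br1_bdd (d k : ℕ) : ∀ᵐ x ∂(srcBranch1 d k), ∀ i, |x i| ≤ 1 := by
  rw [ae_all_iff]; intro i
  exact pi_ae _ i (fun x => |x| ≤ 1) (br1_one_bdd d k i)

theorem br0_zero (d k : ℕ) (i : Fin d) (hi : (i : ℕ) < k) : ∀ᵐ x ∂(srcBranch0 d k), x i = 0 := by
  refine pi_ae _ i (fun x => x = 0) ?_
  rw [if_pos hi, ae_dirac_eq]; simp

theorem br1_one (d k : ℕ) (i : Fin d) (hi : (i : ℕ) < k) :
    ∀ᵐ x ∂(srcBranch1 d k), x i ^ 2 = 1 := by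
  refine pi_ae _ i (fun x => x ^ 2 = 1) ?_
  rw [if_pos hi]
  filter_upwards [unif2_ae] with x hx
  rcases hx with h | h <;> simp [h]

theorem br1_pos (d k : ℕ) (x : Fin d → ℝ)
    (hx : ∀ i : Fin d, x i = -1 ∨ x i = 1 ∨ (k ≤ (i : ℕ) ∧ x i = 0)) (P : (Fin d → ℝ) → Prop)
    (h : ∀ᵐ x ∂(srcBranch1 d k), P x) : P x := by
  by_contra hP
  have h0 : srcBranch1 d k {x} = 0 := by
    refine measure_mono_null ?_ (ae_iff.mp h)
    rintro _ rfl; exact hP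
  unfold srcBranch1 at h0
  rw [Measure.pi_singleton, Finset.prod_eq_zero_iff] at h0
  obtain ⟨i, -, hi⟩ := h0
  by_cases hk : (i : ℕ) < k
  · rw [if_pos hk, unif2_singleton] at hi
    · simp at hi
    · rcases hx i with h | h | h
      · exact Or.inl h
      · exact Or.inr h
      · omega
  · rw [if_neg hk, unif3_singleton] at hi
    · simp at hi
    · rcases hx i with h | h | h
      · exact Or.inl h
      · exact Or.inr (Or.inr h)
      · exact Or.inr (Or.inl h.2)

/-- second moment of the coordinates -/
noncomputable def vcoef (d k : ℕ) (i : Fin d) : ℝ := ∫ x, x ^ 2 ∂(if (i : ℕ) < k then unif2 else unif3)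

theorem vcoef_nonneg (d k : ℕ) (i : Fin d) : 0 ≤ vcoef d k i := integral_nonneg fun x => sq_nonneg x

theorem vcoef_le (d k : ℕ) (i : Fin d) : vcoef d k i ≤ 1 := by
  have : vcoef d k i ≤ ∫ x, (1 : ℝ) ∂(if (i : ℕ) < k then unif2 else unif3) := by
    refine integral_mono_ae (integrable_of_bdd _ (br1_one_bdd d k i) _ (by fun_prop))
      (integrable_const _) ?_
    filter_upwards [br1_one_bdd d k i] with x hx
    simpa using hx
  simpa using this

open ProbabilityTheory in
theorem br1_quad (d k : ℕ) (w : Fin d → ℝ) :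
    ∫ x, (∑ j, w j * x j) ^ 2 ∂(srcBranch1 d k) = ∑ j, vcoef d k j * w j ^ 2 := by
  have hm : ∀ j : Fin d, MemLp (fun x : ℝ => w j * x) 2 (if (j : ℕ) < k then unif2 else unif3) := by
    intro j
    rw [memLp_two_iff_integrable_sq (by fun_prop)]
    exact integrable_of_bdd _ (br1_one_bdd d k j) _ (by fun_prop)
  have hv := variance_sum_pi (μ := fun i : Fin d => if (i : ℕ) < k then unif2 else unif3)
    (X := fun j x => w j * x) hm
  have hmean : ∫ x, (∑ j, w j * x j) ∂(srcBranch1 d k) = 0 := by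
    rw [integral_finsetSum]
    · refine Finset.sum_eq_zero fun j _ => ?_
      rw [integral_const_mul]
      have := integral_comp_eval (μ := fun i : Fin d => if (i : ℕ) < k then unif2 else unif3)
        (i := j) (f := fun x => x) (by fun_prop)
      rw [srcBranch1, this, br1_one_mean, mul_zero]
    · intro j _
      exact integrable_of_bdd_pi _ (br1_bdd d k) _ (by fun_prop)
  have e : (∑ i : Fin d, fun ω : Fin d → ℝ => w i * ω i) = fun ω => ∑ i, w i * ω i := by
    ext ω; simp
  rw [e, ← srcBranch1, variance_of_integral_eq_zero (Measurable.aemeasurable (by fun_prop)) hmean] at hv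
  rw [hv]
  refine Finset.sum_congr rfl fun j _ => ?_
  rw [variance_of_integral_eq_zero (by fun_prop)]
  · simp only [mul_pow]
    rw [integral_const_mul, vcoef, mul_comm]
  · rw [integral_const_mul, br1_one_mean, mul_zero]

theorem qnet_cont {d m : ℕ} (θ : Fin m → ℝ) (φ : Matrix (Fin d) (Fin m) ℝ) :
    Continuous (qnet θ φ) := by
  unfold qnet; fun_prop

theorem br1_qnet {d m : ℕ} (k : ℕ) (θ : Fin m → ℝ) (φ : Matrix (Fin d) (Fin m) ℝ) :
    ∫ x, qnet θ φ x ∂(srcBranch1 d k) = ∑ i, θ i * ∑ j, vcoef d k j * φ j i ^ 2 := by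
  unfold qnet
  rw [integral_finsetSum]
  · refine Finset.sum_congr rfl fun i _ => ?_
    rw [integral_const_mul, br1_quad]
  · intro j _
    exact integrable_of_bdd_pi _ (br1_bdd d k) _ (by fun_prop)

theorem popLoss_eq {d m : ℕ} (k : ℕ) (θ : Fin m → ℝ) (φ : Matrix (Fin d) (Fin m) ℝ) :
    popLoss (sourceMeasure d k) θ φ = 1/3 * ∫ x, (qnet θ φ x) ^ 2 ∂(srcBranch0 d k)
      + 2/3 * ∫ x, (qnet θ φ x - 1) ^ 2 ∂(srcBranch1 d k) := by
  have hc := qnet_cont θ φ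
  have hs : ∀ c : ℝ, StronglyMeasurable (fun p : (Fin d → ℝ) × ℝ => (qnet θ φ p.1 - p.2) ^ 2) :=
    fun _ => Continuous.stronglyMeasurable (by fun_prop)
  have m0 : Measurable (fun x : Fin d → ℝ => (x, (0 : ℝ))) := by fun_prop
  have m1 : Measurable (fun x : Fin d → ℝ => (x, (1 : ℝ))) := by fun_prop
  unfold popLoss sourceMeasure
  rw [integral_add_measure, integral_smul_measure, integral_smul_measure,
    integral_map m0.aemeasurable (hs 0).aestronglyMeasurable,
    integral_map m1.aemeasurable (hs 0).aestronglyMeasurable]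
  · simp
  · refine Integrable.smul_measure ?_ (by simp)
    rw [integrable_map_measure (hs 0).aestronglyMeasurable m0.aemeasurable]
    exact integrable_of_bdd_pi _ (br0_bdd d k) _ (by simp only [Function.comp_def]; fun_prop)
  · refine Integrable.smul_measure ?_ (by finiteness)
    rw [integrable_map_measure (hs 0).aestronglyMeasurable m1.aemeasurable]
    exact integrable_of_bdd_pi _ (br1_bdd d k) _ (by simp only [Function.comp_def]; fun_prop)

/-- Lower bound decomposition -/
theorem popLoss_ge {d m : ℕ} (k : ℕ) (θ : Fin m → ℝ) (φ : Matrix (Fin d) (Fin m) ℝ) (a : ℝ)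
    (ha : a = ∫ x, qnet θ φ x ∂(srcBranch1 d k)) :
    2/3 * (a - 1) ^ 2 + 2/3 * ∫ x, (qnet θ φ x - a) ^ 2 ∂(srcBranch1 d k)
      ≤ popLoss (sourceMeasure d k) θ φ := by
  have hc := qnet_cont θ φ
  have h0 : 0 ≤ ∫ x, (qnet θ φ x) ^ 2 ∂(srcBranch0 d k) := integral_nonneg fun x => sq_nonneg _
  have hI : ∀ f : (Fin d → ℝ) → ℝ, Continuous f → Integrable f (srcBranch1 d k) :=
    fun f hf => integrable_of_bdd_pi _ (br1_bdd d k) f hf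
  have h1 : ∫ x, (qnet θ φ x - 1) ^ 2 ∂(srcBranch1 d k)
      = (a - 1) ^ 2 + ∫ x, (qnet θ φ x - a) ^ 2 ∂(srcBranch1 d k) := by
    have e : ∀ x, (qnet θ φ x - 1) ^ 2
        = (qnet θ φ x - a) ^ 2 + (2 * (a - 1) * qnet θ φ x + (- 2 * a * (a - 1) + (a - 1) ^ 2)) := by
      intro x; ring
    simp_rw [e]
    rw [integral_add (hI _ (by fun_prop)) (hI _ (by fun_prop)),
      integral_add (hI _ (by fun_prop)) (hI _ (by fun_prop)), integral_const_mul, ← ha]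
    simp; ring
  rw [popLoss_eq, h1]; linarith

theorem qnet_single {d m : ℕ} (θ : Fin m → ℝ) (φ : Matrix (Fin d) (Fin m) ℝ) (i0 : Fin m)
    (p : Fin d) (c : ℝ) (h : ∀ l i, φ l i = if i = i0 ∧ l = p then c else 0) (x : Fin d → ℝ) :
    qnet θ φ x = θ i0 * c ^ 2 * x p ^ 2 := by
  unfold qnet
  rw [Finset.sum_eq_single i0]
  · rw [Finset.sum_eq_single p]
    · simp [h]; ring
    · intro j _ hj; simp [h, hj]
    · simp
  · intro i _ hi
    simp [h, hi]
  · simp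

theorem empLoss_nonneg {d m n : ℕ} (S : Fin n → (Fin d → ℝ) × ℝ) (θ : Fin m → ℝ)
    (φ : Matrix (Fin d) (Fin m) ℝ) : 0 ≤ empLoss S θ φ := by
  unfold empLoss; positivity

theorem sInf_meta_nonneg {d m n : ℕ} (Str Sval : Fin n → (Fin d → ℝ) × ℝ)
    (φ : Matrix (Fin d) (Fin m) ℝ) :
    0 ≤ sInf {v : ℝ | ∃ θt : Fin m → ℝ,
        (∀ θ' : Fin m → ℝ, empLoss Str θt φ ≤ empLoss Str θ' φ) ∧ v = empLoss Sval θt φ} := by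
  apply Real.sInf_nonneg
  rintro v ⟨θt, -, rfl⟩
  exact empLoss_nonneg _ _ _

theorem empLoss_zero {d m n : ℕ} (z : Fin d) (S : Fin n → (Fin d → ℝ) × ℝ)
    (hS : ∀ i, (S i).2 = (S i).1 z ^ 2) (φ : Matrix (Fin d) (Fin m) ℝ) (i0 : Fin m)
    (c : ℝ) (hc : c ≠ 0) (h : ∀ l i, φ l i = if i = i0 ∧ l = z then c else 0) :
    empLoss S (fun _ => (c ^ 2)⁻¹) φ = 0 := by
  unfold empLoss
  simp_rw [qnet_single _ φ i0 z c h, hS]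
  have : (c ^ 2)⁻¹ * c ^ 2 = 1 := inv_mul_cancel₀ (by positivity)
  simp [this]

theorem sInf_meta_zero {d m n : ℕ} (z : Fin d) (Str Sval : Fin n → (Fin d → ℝ) × ℝ)
    (htr : ∀ i, (Str i).2 = (Str i).1 z ^ 2) (hval : ∀ i, (Sval i).2 = (Sval i).1 z ^ 2)
    (φ : Matrix (Fin d) (Fin m) ℝ) (i0 : Fin m)
    (c : ℝ) (hc : c ≠ 0) (h : ∀ l i, φ l i = if i = i0 ∧ l = z then c else 0) :
    sInf {v : ℝ | ∃ θt : Fin m → ℝ,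
        (∀ θ' : Fin m → ℝ, empLoss Str θt φ ≤ empLoss Str θ' φ) ∧ v = empLoss Sval θt φ} = 0 := by
  refine le_antisymm ?_ (sInf_meta_nonneg _ _ _)
  refine csInf_le ⟨0, ?_⟩ ⟨fun _ => (c ^ 2)⁻¹, ?_, ?_⟩
  · rintro v ⟨θt, -, rfl⟩
    exact empLoss_nonneg _ _ _
  · intro θ'
    rw [empLoss_zero z Str htr φ i0 c hc h]
    exact empLoss_nonneg _ _ _
  · rw [empLoss_zero z Sval hval φ i0 c hc h]

theorem lsq_exists {n : ℕ} (u y : Fin n → ℝ) :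
    ∃ t : ℝ, ∀ t' : ℝ, ∑ i, (t * u i - y i) ^ 2 ≤ ∑ i, (t' * u i - y i) ^ 2 := by
  have key : ∀ t : ℝ, ∑ i, (t * u i - y i) ^ 2
      = t ^ 2 * (∑ i, u i ^ 2) - 2 * t * (∑ i, u i * y i) + ∑ i, y i ^ 2 := by
    intro t
    rw [Finset.mul_sum, Finset.mul_sum, ← Finset.sum_sub_distrib, ← Finset.sum_add_distrib]
    refine Finset.sum_congr rfl fun i _ => ?_
    ring
  by_cases h0 : ∑ i, u i ^ 2 = 0
  · have hu : ∀ i, u i = 0 := by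
      intro i
      have := (Finset.sum_eq_zero_iff_of_nonneg (fun i _ => sq_nonneg (u i))).mp h0 i (by simp)
      exact pow_eq_zero_iff (two_ne_zero) |>.mp this
    exact ⟨0, fun t' => by simp [hu]⟩
  · have hpos : 0 < ∑ i, u i ^ 2 :=
      lt_of_le_of_ne (Finset.sum_nonneg fun i _ => sq_nonneg _) (Ne.symm h0)
    refine ⟨(∑ i, u i * y i) / ∑ i, u i ^ 2, fun t' => ?_⟩
    rw [key, key]
    set U := ∑ i, u i ^ 2
    set V := ∑ i, u i * y i
    have e : V = (V / U) * U := by field_simp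
    set t := V / U
    rw [e]
    nlinarith [mul_nonneg (sq_nonneg (t' - t)) hpos.le]

theorem sInf_meta_pos {d m n : ℕ} (p : Fin d) (Str Sval : Fin n → (Fin d → ℝ) × ℝ)
    (hval : ∃ i, (Sval i).1 p = 0 ∧ (Sval i).2 = 1)
    (φ : Matrix (Fin d) (Fin m) ℝ) (i0 : Fin m)
    (c : ℝ) (h : ∀ l i, φ l i = if i = i0 ∧ l = p then c else 0) :
    0 < sInf {v : ℝ | ∃ θt : Fin m → ℝ,
        (∀ θ' : Fin m → ℝ, empLoss Str θt φ ≤ empLoss Str θ' φ) ∧ v = empLoss Sval θt φ} := by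
  obtain ⟨i, hi0, hi1⟩ := hval
  have hn : 0 < n := i.pos
  have hn' : (0 : ℝ) < 1 / (n : ℝ) := by positivity
  refine lt_of_lt_of_le hn' ?_
  refine le_csInf ?_ ?_
  · obtain ⟨t, ht⟩ := lsq_exists (fun i => c ^ 2 * (Str i).1 p ^ 2) (fun i => (Str i).2)
    refine ⟨_, fun _ => t, ?_, rfl⟩
    intro θ'
    unfold empLoss
    simp_rw [qnet_single _ φ i0 p c h]
    refine mul_le_mul_of_nonneg_left ?_ hn'.le
    have := ht (θ' i0)
    simpa only [mul_assoc] using this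
  · rintro v ⟨θt, -, rfl⟩
    unfold empLoss
    have : (1 : ℝ) ≤ ∑ i, (qnet θt φ (Sval i).1 - (Sval i).2) ^ 2 := by
      refine le_trans ?_ (Finset.single_le_sum (fun i _ => sq_nonneg _) (Finset.mem_univ i))
      rw [qnet_single _ φ i0 p c h, hi0, hi1]; norm_num
    calc 1 / (n : ℝ) = 1 / (n : ℝ) * 1 := by ring
      _ ≤ _ := mul_le_mul_of_nonneg_left this hn'.le

theorem popLoss_single {d m : ℕ} (k : ℕ) (z : Fin d) (hz : (z : ℕ) < k) (θ : Fin m → ℝ)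
    (φ : Matrix (Fin d) (Fin m) ℝ) (i0 : Fin m) (c : ℝ)
    (h : ∀ l i, φ l i = if i = i0 ∧ l = z then c else 0) :
    popLoss (sourceMeasure d k) θ φ = 2/3 * (θ i0 * c ^ 2 - 1) ^ 2 := by
  rw [popLoss_eq]
  have h0 : ∫ x, (qnet θ φ x) ^ 2 ∂(srcBranch0 d k) = ∫ x, 0 ∂(srcBranch0 d k) := by
    apply integral_congr_ae
    filter_upwards [br0_zero d k z hz] with x hx
    rw [qnet_single _ φ i0 z c h, hx]; simp
  have h1 : ∫ x, (qnet θ φ x - 1) ^ 2 ∂(srcBranch1 d k)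
      = ∫ x, (θ i0 * c ^ 2 - 1) ^ 2 ∂(srcBranch1 d k) := by
    apply integral_congr_ae
    filter_upwards [br1_one d k z hz] with x hx
    rw [qnet_single _ φ i0 z c h, hx]; simp
  rw [h0, h1]; simp

theorem meta_single {d m n : ℕ} (k : ℕ) (lam ρ : ℝ) (z : Fin d) (hz : (z : ℕ) < k)
    (Str Sval : Fin n → (Fin d → ℝ) × ℝ)
    (htr : ∀ i, (Str i).2 = (Str i).1 z ^ 2) (hval : ∀ i, (Sval i).2 = (Sval i).1 z ^ 2)
    (i0 : Fin m) (t c : ℝ) (hc : c ≠ 0) :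
    metaObj k lam ρ Str Sval (fun i => if i = i0 then t else 0)
      (fun l i => if i = i0 ∧ l = z then c else 0)
      = 2/3 * (t * c ^ 2 - 1) ^ 2 + lam * (t ^ 2 + c ^ 2) := by
  unfold metaObj
  rw [sInf_meta_zero z Str Sval htr hval _ i0 c hc (fun _ _ => rfl),
    popLoss_single k z hz _ _ i0 c (fun _ _ => rfl)]
  have e1 : normSq (fun i => if i = i0 then t else 0) = t ^ 2 := by
    unfold normSq
    rw [Finset.sum_eq_single i0] <;> simp +contextual
  have e2 : frobSq (fun (l : Fin d) (i : Fin m) => if i = i0 ∧ l = z then c else 0) = c ^ 2 := by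
    unfold frobSq
    rw [Finset.sum_eq_single z]
    · rw [Finset.sum_eq_single i0] <;> simp +contextual
    · intro b _ hb
      simp [hb]
    · simp
  rw [e1, e2]; simp

theorem one_coord {d : ℕ} (w : Fin d → ℝ) (b : ℝ)
    (h : ∀ x : Fin d → ℝ, (∀ i, x i = -1 ∨ x i = 1) → (∑ j, w j * x j) ^ 2 = b)
    (p q : Fin d) (hpq : p ≠ q) : w p * w q = 0 := by
  have e : ∀ s t : ℝ, (∑ j, w j * (if j = p then s else if j = q then t else 1))
      = (∑ j, w j) + (s - 1) * w p + (t - 1) * w q := by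
    intro s t
    have : ∀ j, w j * (if j = p then s else if j = q then t else 1)
        = w j + (if j = p then (s - 1) * w p else 0) + (if j = q then (t - 1) * w q else 0) := by
      intro j
      by_cases h1 : j = p
      · subst h1; simp [hpq]; ring
      · by_cases h2 : j = q
        · subst h2; simp [h1]; ring
        · simp [h1, h2]
    simp_rw [this]
    rw [Finset.sum_add_distrib, Finset.sum_add_distrib]
    simp
  have H : ∀ s t : ℝ, (s = -1 ∨ s = 1) → (t = -1 ∨ t = 1) →
      ((∑ j, w j) + (s - 1) * w p + (t - 1) * w q) ^ 2 = b := by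
    intro s t hs ht
    rw [← e]
    apply h
    intro i
    split_ifs
    · exact hs
    · exact ht
    · exact Or.inr rfl
  have h1 := H 1 1 (by norm_num) (by norm_num)
  have h2 := H 1 (-1) (by norm_num) (by norm_num)
  have h3 := H (-1) 1 (by norm_num) (by norm_num)
  have h4 := H (-1) (-1) (by norm_num) (by norm_num)
  nlinarith

theorem core {d m n : ℕ} (k : ℕ) (lam ρ : ℝ) (hl : 0 < lam) (hl' : lam < 0.1) (hρ : 0 < ρ)
    (hm : 1 ≤ m) (z : Fin d) (hz : (z : ℕ) = 0) (hk : 2 ≤ k)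
    (Str Sval : Fin n → (Fin d → ℝ) × ℝ)
    (htr : ∀ i, (Str i).2 = (Str i).1 z ^ 2) (hval : ∀ i, (Sval i).2 = (Sval i).1 z ^ 2)
    (hgood : ∀ p : Fin d, (p : ℕ) ≠ 0 → (p : ℕ) < k → ∃ i, (Sval i).1 p = 0 ∧ (Sval i).2 = 1)
    (θ : Fin m → ℝ) (φ : Matrix (Fin d) (Fin m) ℝ)
    (hmin : ∀ (θs' : Fin m → ℝ) (φ' : Matrix (Fin d) (Fin m) ℝ),
      metaObj k lam ρ Str Sval θ φ ≤ metaObj k lam ρ Str Sval θs' φ') :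
    ∃ i0 : Fin m, ∃ c : ℝ, c ≠ 0 ∧ ∀ l i, φ l i = if i = i0 ∧ l = z then c else 0 := by
  have hzk : (z : ℕ) < k := by omega
  obtain ⟨a, ha⟩ : ∃ a, a = ∫ x, qnet θ φ x ∂(srcBranch1 d k) := ⟨_, rfl⟩
  have hge := popLoss_ge k θ φ a ha
  have hM := sInf_meta_nonneg Str Sval φ
  have hV : 0 ≤ ∫ x, (qnet θ φ x - a) ^ 2 ∂(srcBranch1 d k) := integral_nonneg fun x => sq_nonneg _
  have hnθ : 0 ≤ normSq θ := by unfold normSq; positivity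
  have hnφ : 0 ≤ frobSq φ := by unfold frobSq; positivity
  have hcomp : ∀ t c : ℝ, c ≠ 0 → metaObj k lam ρ Str Sval θ φ
      ≤ 2/3 * (t * c ^ 2 - 1) ^ 2 + lam * (t ^ 2 + c ^ 2) := by
    intro t c hc
    rw [← meta_single k lam ρ z hzk Str Sval htr hval (⟨0, hm⟩ : Fin m) t c hc]
    exact hmin _ _
  unfold metaObj at hcomp
  set M := sInf {v : ℝ | ∃ θt : Fin m → ℝ,
        (∀ θ' : Fin m → ℝ, empLoss Str θt φ ≤ empLoss Str θ' φ) ∧ v = empLoss Sval θt φ} with hMdef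
  have hρM : 0 ≤ ρ * M := mul_nonneg hρ.le hM
  have hapos : 0 < a := by
    by_contra hneg
    have h1 := hcomp 1 1 one_ne_zero
    have : 0 ≤ lam * (normSq θ + frobSq φ) := by positivity
    norm_num at h1 hl'
    nlinarith
  -- reg bound
  obtain ⟨r, hr⟩ : ∃ r : Fin m → ℝ, ∀ i, r i = ∑ j, φ j i ^ 2 := ⟨_, fun _ => rfl⟩
  have hr0 : ∀ i, 0 ≤ r i := fun i => by rw [hr]; positivity
  have hfr : frobSq φ = ∑ i, r i := by
    unfold frobSq; rw [Finset.sum_comm]; simp_rw [hr]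
  obtain ⟨t, ht⟩ : ∃ t, t = Real.sqrt (normSq θ) := ⟨_, rfl⟩
  have ht0 : 0 ≤ t := ht ▸ Real.sqrt_nonneg _
  have ht2 : t ^ 2 = normSq θ := by rw [ht, Real.sq_sqrt hnθ]
  have hθt : ∀ i, |θ i| ≤ t := by
    intro i
    rw [ht]
    apply Real.abs_le_sqrt
    exact Finset.single_le_sum (f := fun i => θ i ^ 2) (fun i _ => sq_nonneg _) (Finset.mem_univ i)
  have ha1 : a ≤ ∑ i, |θ i| * r i := by
    rw [ha, br1_qnet]
    refine Finset.sum_le_sum fun i _ => ?_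
    have h1 : ∑ j, vcoef d k j * φ j i ^ 2 ≤ r i := by
      rw [hr]
      exact Finset.sum_le_sum fun j _ => mul_le_of_le_one_left (sq_nonneg _) (vcoef_le d k j)
    have h2 : 0 ≤ ∑ j, vcoef d k j * φ j i ^ 2 :=
      Finset.sum_nonneg fun j _ => mul_nonneg (vcoef_nonneg d k j) (sq_nonneg _)
    exact mul_le_mul (le_abs_self _) h1 h2 (abs_nonneg _)
  have ha2 : ∑ i, |θ i| * r i ≤ t * frobSq φ := by
    rw [hfr, Finset.mul_sum]
    exact Finset.sum_le_sum fun i _ => mul_le_mul_of_nonneg_right (hθt i) (hr0 i)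
  have htpos : 0 < t := by
    rcases ht0.lt_or_eq with h | h
    · exact h
    · rw [← h] at ha2; linarith
  have hc0 : 0 < Real.sqrt (a / t) := Real.sqrt_pos.mpr (by positivity)
  have hc2 : Real.sqrt (a / t) ^ 2 = a / t := Real.sq_sqrt (by positivity)
  have hfin := hcomp t _ hc0.ne'
  rw [hc2, mul_div_cancel₀ _ htpos.ne', ht2] at hfin
  have hdiv : a / t ≤ frobSq φ := by
    rw [div_le_iff₀ htpos]; linarith [mul_comm t (frobSq φ)]
  have hlr : lam * (a / t) ≤ lam * frobSq φ := mul_le_mul_of_nonneg_left hdiv hl.le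
  have hV0 : ∫ x, (qnet θ φ x - a) ^ 2 ∂(srcBranch1 d k) = 0 := by linarith
  have hM0 : M = 0 := by
    have : ρ * M = 0 := by linarith
    exact (mul_eq_zero.mp this).resolve_left hρ.ne'
  have hF : frobSq φ = a / t := by
    have : lam * frobSq φ = lam * (a / t) := by linarith
    exact mul_left_cancel₀ hl.ne' this
  have hsum : ∑ i, |θ i| * r i = t * frobSq φ := by
    refine le_antisymm ha2 ?_
    rw [hF, mul_div_cancel₀ _ htpos.ne']; exact ha1
  have hterm : ∀ i, r i ≠ 0 → |θ i| = t := by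
    intro i hi
    have h0 : ∑ i, (t - |θ i|) * r i = 0 := by
      simp_rw [sub_mul]
      rw [Finset.sum_sub_distrib, hsum, hfr, Finset.mul_sum, sub_self]
    have := (Finset.sum_eq_zero_iff_of_nonneg
      (fun i _ => mul_nonneg (sub_nonneg.mpr (hθt i)) (hr0 i))).mp h0 i (Finset.mem_univ i)
    have := (mul_eq_zero.mp this).resolve_right hi
    linarith
  obtain ⟨i0, hi0⟩ : ∃ i0, r i0 ≠ 0 := by
    by_contra hcon
    push Not at hcon
    have : frobSq φ = 0 := by rw [hfr]; exact Finset.sum_eq_zero fun i _ => hcon i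
    rw [this] at hF
    have : 0 < a / t := by positivity
    linarith
  have hθi0 := hterm i0 hi0
  have hothers : ∀ i, i ≠ i0 → r i = 0 := by
    intro i hi
    by_contra hne
    have h1 := hterm i hne
    have h2 : θ i ^ 2 + θ i0 ^ 2 ≤ normSq θ := by
      unfold normSq
      rw [← Finset.sum_pair (f := fun i => θ i ^ 2) hi]
      exact Finset.sum_le_sum_of_subset_of_nonneg (Finset.subset_univ _) fun i _ _ => sq_nonneg _
    rw [← sq_abs (θ i), ← sq_abs (θ i0), h1, hθi0, ← ht2] at h2
    nlinarith
  have hcol : ∀ i, i ≠ i0 → ∀ l, φ l i = 0 := by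
    intro i hi l
    have h0 := hothers i hi
    rw [hr] at h0
    have := (Finset.sum_eq_zero_iff_of_nonneg (fun j _ => sq_nonneg (φ j i))).mp h0 l
      (Finset.mem_univ l)
    exact pow_eq_zero_iff (two_ne_zero) |>.mp this
  have hq : ∀ x, qnet θ φ x = θ i0 * (∑ j, φ j i0 * x j) ^ 2 := by
    intro x
    unfold qnet
    rw [Finset.sum_eq_single i0]
    · intro i _ hi; simp [hcol i hi]
    · simp
  have hae : ∀ᵐ x ∂(srcBranch1 d k), qnet θ φ x = a := by
    have hc := qnet_cont θ φ
    have := (integral_eq_zero_iff_of_nonneg (fun x => sq_nonneg (qnet θ φ x - a))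
      (integrable_of_bdd_pi _ (br1_bdd d k) _ (by fun_prop))).mp hV0
    filter_upwards [this] with x hx
    have : (qnet θ φ x - a) ^ 2 = 0 := hx
    have := pow_eq_zero_iff (two_ne_zero) |>.mp this
    linarith
  have hθ0 : θ i0 ≠ 0 := by
    intro h; rw [h, abs_zero] at hθi0; linarith
  have hprod := one_coord (fun j => φ j i0) (a / θ i0) (by
    intro x hx
    have := br1_pos d k x (fun i => (hx i).elim Or.inl (fun h => Or.inr (Or.inl h))) _ hae
    rw [hq] at this
    rw [← this]; field_simp)
  obtain ⟨p, hp⟩ : ∃ p, φ p i0 ≠ 0 := by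
    by_contra hcon
    push Not at hcon
    apply hi0
    rw [hr]; exact Finset.sum_eq_zero fun j _ => by rw [hcon j]; simp
  have hform : ∀ l i, φ l i = if i = i0 ∧ l = p then φ p i0 else 0 := by
    intro l i
    by_cases hi : i = i0
    · subst hi
      by_cases hlp : l = p
      · simp [hlp]
      · have := hprod p l (Ne.symm hlp)
        simpa [hlp] using (mul_eq_zero.mp this).resolve_left hp
    · simp [hi, hcol i hi]
  have hpk : (p : ℕ) < k := by
    by_contra hcon
    have := br1_pos d k (fun j => if j = p then 0 else 1) (by
      intro i
      by_cases h : i = p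
      · subst h; simp; omega
      · simp [h]) _ hae
    rw [qnet_single θ φ i0 p _ hform] at this
    simp at this
    linarith
  have hp0 : (p : ℕ) = 0 := by
    by_contra hcon
    have := sInf_meta_pos p Str Sval (hgood p hcon hpk) φ i0 _ hform
    rw [← hMdef, hM0] at this
    exact lt_irrefl _ this
  have hpz : p = z := Fin.ext (by omega)
  subst hpz
  exact ⟨i0, _, hp, hform⟩

theorem core2 {d m n : ℕ} (z : Fin d) (hz : (z : ℕ) = 0)
    (Str : Fin n → (Fin d → ℝ) × ℝ)
    (htr : ∀ i, (Str i).2 = (Str i).1 z ^ 2) (h1 : ∃ i, (Str i).2 = 1)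
    (φ : Matrix (Fin d) (Fin m) ℝ) (i0 : Fin m) (c : ℝ) (hc : c ≠ 0)
    (h : ∀ l i, φ l i = if i = i0 ∧ l = z then c else 0) (θt : Fin m → ℝ)
    (hmin : ∀ θ' : Fin m → ℝ, empLoss Str θt φ ≤ empLoss Str θ' φ) :
    popLoss (targetMeasure d) θt φ = 0 := by
  obtain ⟨i, hi⟩ := h1
  have hn : 0 < n := i.pos
  have h0 := hmin (fun _ => (c ^ 2)⁻¹)
  rw [empLoss_zero z Str htr φ i0 c hc h] at h0
  have h0 : empLoss Str θt φ = 0 := le_antisymm h0 (empLoss_nonneg _ _ _)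
  unfold empLoss at h0
  have h0 := (mul_eq_zero.mp h0).resolve_left (by positivity)
  have h0 := (Finset.sum_eq_zero_iff_of_nonneg (fun j _ => sq_nonneg _)).mp h0 i (Finset.mem_univ i)
  have h0 := pow_eq_zero_iff (two_ne_zero) |>.mp h0
  rw [qnet_single θt φ i0 z c h, ← htr, hi] at h0
  unfold targetMeasure
  rw [popLoss_single 1 z (by omega) θt φ i0 c h]
  have : θt i0 * c ^ 2 - 1 = 0 := by linarith
  rw [this]; simp

theorem tgt_apply (d : ℕ) (s : Set ((Fin d → ℝ) × ℝ)) (hs : MeasurableSet s) :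
    targetMeasure d s = 1/3 * srcBranch0 d 1 {x | (x, (0 : ℝ)) ∈ s}
      + 2/3 * srcBranch1 d 1 {x | (x, (1 : ℝ)) ∈ s} := by
  unfold targetMeasure sourceMeasure
  rw [Measure.add_apply, Measure.smul_apply, Measure.smul_apply,
    Measure.map_apply (by fun_prop) hs, Measure.map_apply (by fun_prop) hs]
  rfl

instance instTgt (d : ℕ) : IsProbabilityMeasure (targetMeasure d) := by
  constructor
  rw [tgt_apply _ _ MeasurableSet.univ]
  simp only [Set.mem_univ, Set.setOf_true, measure_univ, mul_one]
  rw [ENNReal.div_add_div_same]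
  norm_num
  exact ENNReal.div_self (by norm_num) (by norm_num)

theorem tgt_null (d : ℕ) (z : Fin d) (hz : (z : ℕ) = 0) :
    targetMeasure d {p | ¬ (p.2 = p.1 z ^ 2)} = 0 := by
  rw [tgt_apply]
  · have h0 : srcBranch0 d 1 {x | (x, (0 : ℝ)) ∈ {p : (Fin d → ℝ) × ℝ | ¬ (p.2 = p.1 z ^ 2)}} = 0 := by
      rw [← nonpos_iff_eq_zero, ← ae_iff.mp (br0_zero d 1 z (by omega))]
      refine measure_mono fun x hx => ?_
      simp only [Set.mem_setOf_eq] at hx ⊢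
      intro h; rw [h] at hx; simp at hx
    have h1 : srcBranch1 d 1 {x | (x, (1 : ℝ)) ∈ {p : (Fin d → ℝ) × ℝ | ¬ (p.2 = p.1 z ^ 2)}} = 0 := by
      rw [← nonpos_iff_eq_zero, ← ae_iff.mp (br1_one d 1 z (by omega))]
      refine measure_mono fun x hx => ?_
      simp only [Set.mem_setOf_eq] at hx ⊢
      intro h; rw [h] at hx; simp at hx
    rw [h0, h1]; simp
  · exact (measurableSet_eq_fun (by fun_prop) (by fun_prop)).compl

theorem enn_arith : (1/3 : ENNReal) + 2/3 * (2/3) = 7/9 := by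
  rw [← ENNReal.toReal_eq_toReal_iff' (by finiteness) (by finiteness),
    ENNReal.toReal_add (by finiteness) (by finiteness)]
  simp
  norm_num

theorem tgt_y (d : ℕ) : targetMeasure d {p | ¬ (p.2 = 1)} ≤ 7/9 := by
  rw [tgt_apply]
  · simp only [Set.mem_setOf_eq]
    simp
    rw [← enn_arith]
    simp
  · exact (measurableSet_eq_fun (by fun_prop) (by fun_prop)).compl

theorem tgt_p (d : ℕ) (p : Fin d) (hp : (p : ℕ) ≠ 0) :
    targetMeasure d {q | ¬ (q.1 p = 0 ∧ q.2 = 1)} ≤ 7/9 := by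
  have hms : MeasurableSet {x : Fin d → ℝ | x p = 0} :=
    measurableSet_eq_fun (by fun_prop) (by fun_prop)
  have hb : srcBranch1 d 1 {x | x p = 0} = 3⁻¹ := by
    have h := (measurePreserving_eval
      (fun i : Fin d => if (i : ℕ) < 1 then unif2 else unif3) p).measure_preimage
      (measurableSet_singleton (0 : ℝ)).nullMeasurableSet
    rw [if_neg (by omega), unif3_singleton _ (by simp)] at h
    exact h
  have hb' : srcBranch1 d 1 {x | ¬ x p = 0} = 2/3 := by
    have := prob_compl_eq_one_sub (μ := srcBranch1 d 1) hms
    rw [hb] at this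
    rw [show {x : Fin d → ℝ | ¬ x p = 0} = {x | x p = 0}ᶜ from rfl, this]
    rw [← ENNReal.toReal_eq_toReal_iff' (by finiteness) (by finiteness),
      ENNReal.toReal_sub_of_le (by simp) (by simp)]
    simp; norm_num
  rw [tgt_apply]
  · simp only [Set.mem_setOf_eq, and_true]
    rw [hb', ← enn_arith]
    gcongr
    exact mul_le_of_le_one_right' prob_le_one
  · exact (MeasurableSet.inter (measurableSet_eq_fun (by fun_prop) (by fun_prop))
      (measurableSet_eq_fun (by fun_prop) (by fun_prop))).compl

theorem pi_val {α : Type*} [MeasurableSpace α] (μ : Measure α) [IsProbabilityMeasure μ] (n : ℕ)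
    (B : Set α) (b : ENNReal) (hb : μ B ≤ b) :
    Measure.pi (fun _ : Fin (n + n) => μ) {S | ∀ i : Fin n, S (Fin.natAdd n i) ∈ B} ≤ b ^ n := by
  have e : {S : Fin (n + n) → α | ∀ i : Fin n, S (Fin.natAdd n i) ∈ B}
      = Set.pi Set.univ (Fin.addCases (motive := fun _ => Set α) (fun _ => Set.univ) (fun _ => B)) := by
    ext S
    simp only [Set.mem_setOf_eq, Set.mem_pi, Set.mem_univ, true_imp_iff]
    constructor
    · intro h j
      refine Fin.addCases (fun i => ?_) (fun i => ?_) j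
      · simp
      · simpa only [Fin.addCases_right] using h i
    · intro h i
      simpa only [Fin.addCases_right] using h (Fin.natAdd n i)
  rw [e, Measure.pi_pi, Fin.prod_univ_add]
  simp only [Fin.addCases_left, Fin.addCases_right, measure_univ, Finset.prod_const_one, one_mul,
    Finset.prod_const, Finset.card_univ, Fintype.card_fin]
  gcongr

theorem pi_tr {α : Type*} [MeasurableSpace α] (μ : Measure α) [IsProbabilityMeasure μ] (n : ℕ)
    (B : Set α) (b : ENNReal) (hb : μ B ≤ b) :
    Measure.pi (fun _ : Fin (n + n) => μ) {S | ∀ i : Fin n, S (Fin.castAdd n i) ∈ B} ≤ b ^ n := by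
  have e : {S : Fin (n + n) → α | ∀ i : Fin n, S (Fin.castAdd n i) ∈ B}
      = Set.pi Set.univ (Fin.addCases (motive := fun _ => Set α) (fun _ => B) (fun _ => Set.univ)) := by
    ext S
    simp only [Set.mem_setOf_eq, Set.mem_pi, Set.mem_univ, true_imp_iff]
    constructor
    · intro h j
      refine Fin.addCases (fun i => ?_) (fun i => ?_) j
      · simpa using h i
      · simp only [Fin.addCases_right, Set.mem_univ]
    · intro h i
      simpa using h (Fin.castAdd n i)
  rw [e, Measure.pi_pi, Fin.prod_univ_add]
  simp only [Fin.addCases_left, Fin.addCases_right, measure_univ, Finset.prod_const_one, mul_one,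
    Finset.prod_const, Finset.card_univ, Fintype.card_fin]
  gcongr

theorem num_bound (k n : ℕ) (hk : 2 ≤ k) (ξ : ℝ) (h0 : 0 < ξ)
    (h : 10 * Real.log ((k : ℝ) / ξ) ≤ ((n + n : ℕ) : ℝ)) :
    (k : ENNReal) * (7/9) ^ n ≤ ENNReal.ofReal ξ := by
  have hk0 : (0 : ℝ) < k := by positivity
  have hlog : (1/5 : ℝ) ≤ Real.log (9/7) := by
    have := Real.one_sub_inv_le_log_of_pos (show (0 : ℝ) < 9/7 by norm_num)
    norm_num at this ⊢
    linarith
  have h1 : Real.log ((k : ℝ) / ξ) ≤ n * Real.log (9/7) := by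
    push_cast at h
    have : (n : ℝ) * (1/5) ≤ n * Real.log (9/7) := by gcongr
    linarith
  have h2 : (k : ℝ) / ξ ≤ (9/7) ^ n := by
    rw [← Real.log_pow] at h1
    exact (Real.log_le_log_iff (by positivity) (by positivity)).mp h1
  have h3 : (k : ℝ) * (7/9) ^ n ≤ ξ := by
    rw [div_le_iff₀ h0] at h2
    have e : ((9/7 : ℝ)) ^ n * (7/9) ^ n = 1 := by rw [← mul_pow]; norm_num
    calc (k : ℝ) * (7/9) ^ n ≤ ((9/7) ^ n * ξ) * (7/9) ^ n := by gcongr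
      _ = ξ * ((9/7 : ℝ) ^ n * (7/9) ^ n) := by ring
      _ = ξ := by rw [e, mul_one]
  have e : (k : ENNReal) * (7/9) ^ n = ENNReal.ofReal ((k : ℝ) * (7/9) ^ n) := by
    rw [ENNReal.ofReal_mul hk0.le, ENNReal.ofReal_pow (by norm_num),
      ENNReal.ofReal_div_of_pos (by norm_num)]
    simp
  rw [e]
  exact ENNReal.ofReal_le_ofReal h3

open MeasureTheory in
/-- Theorem 2: with probability at least `1 - ξ` over a target sample of size `n + n`
(split into training and validation halves), every global minimizer of the MeRLin objective
has exactly one nonzero column, a nonzero multiple of `e_1`, and every head fitted on the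
training split recovers the target ground truth. -/
theorem merlin_succeeds :
    ∃ C : ℝ, 0 < C ∧
      ∀ d k m n : ℕ, 2 ≤ k → k ≤ d → 1 ≤ m →
      ∀ lam ρ ξ : ℝ, 0 < lam → lam < 0.1 → 0 < ρ → 0 < ξ → ξ < 1 →
      C * Real.log ((k : ℝ) / ξ) ≤ ((n + n : ℕ) : ℝ) →
      (Measure.pi (fun _ : Fin (n + n) => targetMeasure d))
        {S : Fin (n + n) → (Fin d → ℝ) × ℝ |
          ∀ (θs : Fin m → ℝ) (φ : Matrix (Fin d) (Fin m) ℝ),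
            (∀ (θs' : Fin m → ℝ) (φ' : Matrix (Fin d) (Fin m) ℝ),
                metaObj k lam ρ (fun i : Fin n => S (Fin.castAdd n i))
                    (fun i : Fin n => S (Fin.natAdd n i)) θs φ
                  ≤ metaObj k lam ρ (fun i : Fin n => S (Fin.castAdd n i))
                      (fun i : Fin n => S (Fin.natAdd n i)) θs' φ') →
            ((∃ i0 : Fin m,
                (∃ c : ℝ, c ≠ 0 ∧ ∀ l : Fin d, φ l i0 = c * (if (l : ℕ) = 0 then 1 else 0)) ∧
                ∀ i : Fin m, i ≠ i0 → ∀ l : Fin d, φ l i = 0) ∧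
              ∀ θt : Fin m → ℝ,
                (∀ θ' : Fin m → ℝ,
                    empLoss (fun i : Fin n => S (Fin.castAdd n i)) θt φ
                      ≤ empLoss (fun i : Fin n => S (Fin.castAdd n i)) θ' φ) →
                popLoss (targetMeasure d) θt φ = 0)}
        ≥ ENNReal.ofReal (1 - ξ) := by
  refine ⟨10, by norm_num, ?_⟩
  intro d k m n hk hkd hm lam ρ ξ hl hl' hρ hξ hξ' hn
  have hd : 0 < d := by omega
  set μ := Measure.pi (fun _ : Fin (n + n) => targetMeasure d) with hμ
  let z : Fin d := ⟨0, hd⟩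
  let G : Set (Fin (n + n) → (Fin d → ℝ) × ℝ) := {S | (∀ i, (S i).2 = (S i).1 z ^ 2) ∧
    (∃ i : Fin n, (S (Fin.castAdd n i)).2 = 1) ∧
    ∀ p : Fin d, (p : ℕ) ≠ 0 → (p : ℕ) < k →
      ∃ i : Fin n, (S (Fin.natAdd n i)).1 p = 0 ∧ (S (Fin.natAdd n i)).2 = 1}
  have hGc : μ Gᶜ ≤ ENNReal.ofReal ξ := by
    let f : Fin (k - 1) → Fin d := fun q => ⟨q + 1, by omega⟩
    have hsub : Gᶜ ⊆ (⋃ i : Fin (n + n), {S | S i ∈ {p : (Fin d → ℝ) × ℝ | ¬ (p.2 = p.1 z ^ 2)}})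
        ∪ ({S | ∀ i : Fin n, S (Fin.castAdd n i) ∈ {p : (Fin d → ℝ) × ℝ | ¬ (p.2 = 1)}}
        ∪ ⋃ q : Fin (k - 1), {S | ∀ i : Fin n, S (Fin.natAdd n i) ∈
            {p : (Fin d → ℝ) × ℝ | ¬ (p.1 (f q) = 0 ∧ p.2 = 1)}}) := by
      intro S hS
      by_contra hcon
      apply hS
      simp only [Set.mem_union, Set.mem_iUnion, Set.mem_setOf_eq, not_or, not_exists, not_forall,
        not_not] at hcon
      obtain ⟨c1, c2, c3⟩ := hcon
      refine ⟨c1, c2, fun p hp hpk => ?_⟩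
      have := c3 ⟨(p : ℕ) - 1, by omega⟩
      have e : f ⟨(p : ℕ) - 1, by omega⟩ = p := Fin.ext (by simp [f]; omega)
      rwa [e] at this
    have h1 : μ (⋃ i : Fin (n + n), {S | S i ∈ {p : (Fin d → ℝ) × ℝ | ¬ (p.2 = p.1 z ^ 2)}}) = 0 := by
      rw [measure_iUnion_null_iff]
      intro i
      exact (measurePreserving_eval (fun _ : Fin (n + n) => targetMeasure d)
        i).quasiMeasurePreserving.preimage_null (tgt_null d z rfl)
    have h2 := pi_tr (targetMeasure d) n _ _ (tgt_y d)
    have h3 : μ (⋃ q : Fin (k - 1), {S | ∀ i : Fin n, S (Fin.natAdd n i) ∈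
            {p : (Fin d → ℝ) × ℝ | ¬ (p.1 (f q) = 0 ∧ p.2 = 1)}}) ≤ ((k - 1 : ℕ) : ENNReal) * (7/9) ^ n := by
      refine (measure_iUnion_fintype_le _ _).trans ?_
      refine (Finset.sum_le_sum fun q _ =>
        pi_val (targetMeasure d) n _ _ (tgt_p d (f q) (by simp [f]))).trans ?_
      simp
    calc μ Gᶜ ≤ _ := measure_mono hsub
      _ ≤ 0 + ((7/9) ^ n + ((k - 1 : ℕ) : ENNReal) * (7/9) ^ n) := by
        refine (measure_union_le _ _).trans ?_
        rw [h1]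
        gcongr
        exact (measure_union_le _ _).trans (add_le_add h2 h3)
      _ = (((k - 1 : ℕ) + 1 : ℕ) : ENNReal) * (7/9) ^ n := by push_cast; ring
      _ = (k : ENNReal) * (7/9) ^ n := by rw [Nat.sub_add_cancel (by omega)]
      _ ≤ _ := num_bound k n hk ξ hξ hn
  have hG : ENNReal.ofReal (1 - ξ) ≤ μ G := by
    have h1 : (1 : ENNReal) ≤ μ G + μ Gᶜ := by
      rw [← measure_univ (μ := μ), ← Set.union_compl_self G]
      exact measure_union_le _ _
    rw [ENNReal.ofReal_sub _ hξ.le, ENNReal.ofReal_one]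
    exact tsub_le_iff_right.mpr (h1.trans (by gcongr))
  refine hG.trans (measure_mono ?_)
  rintro S ⟨g1, g2, g3⟩ θs φ hmin
  obtain ⟨i0, c, hc, h⟩ := core k lam ρ hl hl' hρ hm z rfl hk _ _ (fun i => g1 _) (fun i => g1 _)
    g3 θs φ hmin
  refine ⟨⟨i0, ⟨c, hc, fun l => ?_⟩, fun i hi l => ?_⟩, fun θt hθt => ?_⟩
  · rw [h]
    by_cases hl : (l : ℕ) = 0
    · have : l = z := Fin.ext hl
      simp [this, z]
    · have : l ≠ z := fun e => hl (by rw [e])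
      simp [this, hl]
  · rw [h]; simp [hi]
  · exact core2 z rfl _ (fun i => g1 _) g2 φ i0 c hc h θt hθt
end

section
/- Let θ ∈ ℝ^m and w_1, …, w_m ∈ ℝ^d, and set A = Σ_{i=1}^m θ_i w_i w_i^T ∈ ℝ^{d×d}. Then Σ_{i=1}^m (θ_i^2 + ‖w_i‖^2) ≥ (3/2^{2/3})·(Σ_{i=1}^m |θ_i|·‖w_i‖^2)^{2/3} ≥ (3/2^{2/3})·(Σ_{j=1}^d |A_{jj}|)^{2/3}, and likewise Σ_{i=1}^m (θ_i^2 + (1/2)‖w_i‖^2) ≥ (3/2^{4/3})·(Σ_{i=1}^m |θ_i|·‖w_i‖^2)^{2/3} ≥ (3/2^{4/3})·(Σ_{j=1}^d |A_{jj}|)^{2/3}. -/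
open Finset

theorem rpow_aux (X T K c : ℝ) (hX : 0 ≤ X) (hT : 0 ≤ T) (hK : K ^ 3 = c)
    (h : c * X ^ 2 ≤ T ^ 3) : K * X ^ ((2 : ℝ) / 3) ≤ T := by
  have h1 : (X ^ ((2 : ℝ) / 3)) ^ 3 = X ^ 2 := by
    rw [← Real.rpow_natCast, ← Real.rpow_mul hX, ← Real.rpow_natCast]
    norm_num
  refine le_of_pow_le_pow_left₀ (n := 3) (by norm_num) hT ?_
  rw [mul_pow, h1, hK]
  exact h

theorem amgm_aux (P s : ℝ) (hP : 0 ≤ P) (hs : 0 ≤ s) : 27 / 4 * (P * s ^ 2) ≤ (P + s) ^ 3 := by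
  have : 0 ≤ (P - s / 2) ^ 2 * (P + 4 * s) := by positivity
  nlinarith [this]

/-- The AM-GM regularizer bounds: with `A = ∑ i, θ_i w_i w_iᵀ`,
`∑ i (θ_i² + ‖w_i‖²) ≥ (3/2^{2/3}) (∑ i |θ_i| ‖w_i‖²)^{2/3} ≥ (3/2^{2/3}) (∑ j |A_{jj}|)^{2/3}`
and
`∑ i (θ_i² + ½‖w_i‖²) ≥ (3/2^{4/3}) (∑ i |θ_i| ‖w_i‖²)^{2/3} ≥ (3/2^{4/3}) (∑ j |A_{jj}|)^{2/3}`. -/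
theorem regularizer_amgm_bounds (m d : ℕ) (θ : Fin m → ℝ) (w : Fin m → Fin d → ℝ)
    (A : Matrix (Fin d) (Fin d) ℝ)
    (hA : A = ∑ i, θ i • Matrix.vecMulVec (w i) (w i)) :
    ((3 / (2 : ℝ) ^ ((2 : ℝ) / 3)) * (∑ i, |θ i| * ∑ j, (w i j) ^ 2) ^ ((2 : ℝ) / 3)
        ≤ ∑ i, ((θ i) ^ 2 + ∑ j, (w i j) ^ 2)
      ∧ (3 / (2 : ℝ) ^ ((2 : ℝ) / 3)) * (∑ j, |A j j|) ^ ((2 : ℝ) / 3)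
        ≤ (3 / (2 : ℝ) ^ ((2 : ℝ) / 3)) * (∑ i, |θ i| * ∑ j, (w i j) ^ 2) ^ ((2 : ℝ) / 3))
    ∧ ((3 / (2 : ℝ) ^ ((4 : ℝ) / 3)) * (∑ i, |θ i| * ∑ j, (w i j) ^ 2) ^ ((2 : ℝ) / 3)
        ≤ ∑ i, ((θ i) ^ 2 + (1 / 2) * ∑ j, (w i j) ^ 2)
      ∧ (3 / (2 : ℝ) ^ ((4 : ℝ) / 3)) * (∑ j, |A j j|) ^ ((2 : ℝ) / 3)
        ≤ (3 / (2 : ℝ) ^ ((4 : ℝ) / 3)) * (∑ i, |θ i| * ∑ j, (w i j) ^ 2) ^ ((2 : ℝ) / 3)) := by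
  have hs : ∀ i, 0 ≤ ∑ j, (w i j) ^ 2 := fun i => Finset.sum_nonneg fun j _ => sq_nonneg _
  have hP : 0 ≤ ∑ i, (θ i) ^ 2 := Finset.sum_nonneg fun j _ => sq_nonneg _
  have hS : 0 ≤ ∑ i, ∑ j, (w i j) ^ 2 := Finset.sum_nonneg fun i _ => hs i
  have hX : 0 ≤ ∑ i, |θ i| * ∑ j, (w i j) ^ 2 :=
    Finset.sum_nonneg fun i _ => mul_nonneg (abs_nonneg _) (hs i)
  have hXS : (∑ i, |θ i| * ∑ j, (w i j) ^ 2) ≤ √(∑ i, (θ i) ^ 2) * ∑ i, ∑ j, (w i j) ^ 2 := by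
    rw [Finset.mul_sum]
    refine Finset.sum_le_sum fun i _ => mul_le_mul_of_nonneg_right ?_ (hs i)
    refine Real.abs_le_sqrt ?_
    exact Finset.single_le_sum (f := fun i => (θ i) ^ 2) (fun j _ => sq_nonneg _) (Finset.mem_univ i)
  have hX2 := pow_le_pow_left₀ hX hXS 2
  rw [mul_pow, Real.sq_sqrt hP] at hX2
  have hAX : ∑ j, |A j j| ≤ ∑ i, |θ i| * ∑ j, (w i j) ^ 2 := by
    simp_rw [Finset.mul_sum]
    rw [Finset.sum_comm]
    refine Finset.sum_le_sum fun j _ => ?_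
    rw [hA, Matrix.sum_apply]
    refine (Finset.abs_sum_le_sum_abs _ _).trans (le_of_eq ?_)
    refine Finset.sum_congr rfl fun i _ => ?_
    rw [Matrix.smul_apply, Matrix.vecMulVec_apply, smul_eq_mul, abs_mul, abs_mul_self, sq]
  have hA0 : 0 ≤ ∑ j, |A j j| := Finset.sum_nonneg fun j _ => abs_nonneg _
  have hpow := Real.rpow_le_rpow hA0 hAX (by norm_num : (0 : ℝ) ≤ 2 / 3)
  have k1 : (3 / (2 : ℝ) ^ ((2 : ℝ) / 3)) ^ 3 = 27 / 4 := by
    rw [div_pow, ← Real.rpow_natCast (2 ^ _), ← Real.rpow_mul (by norm_num)]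
    norm_num
  have k2 : (3 / (2 : ℝ) ^ ((4 : ℝ) / 3)) ^ 3 = 27 / 16 := by
    rw [div_pow, ← Real.rpow_natCast (2 ^ _), ← Real.rpow_mul (by norm_num)]
    norm_num
  refine ⟨⟨?_, mul_le_mul_of_nonneg_left hpow (by positivity)⟩,
    ⟨?_, mul_le_mul_of_nonneg_left hpow (by positivity)⟩⟩
  · rw [Finset.sum_add_distrib]
    refine rpow_aux _ _ _ _ hX (add_nonneg hP hS) k1 ?_
    have := amgm_aux _ _ hP hS
    linarith
  · rw [Finset.sum_add_distrib, ← Finset.mul_sum]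
    have hS' : 0 ≤ 1 / 2 * ∑ i, ∑ j, (w i j) ^ 2 := by linarith
    refine rpow_aux _ _ _ _ hX (add_nonneg hP hS') k2 ?_
    have := amgm_aux _ _ hP hS'
    rw [mul_pow] at this
    linarith
end

section
/- Let 0 ≤ ε ≤ 2/3. Every pair (θ_t, φ) with θ_t ∈ ℝ^m, φ ∈ ℝ^{d×m} whose target population loss satisfies E_{(x,y)∼D_t}[(f_{θ_t,φ}(x) − y)^2] ≤ ε obeys the norm lower bound ‖θ_t‖^2 + (1/2)‖φ‖_F^2 ≥ (3/2^{4/3})·(1 − √(3ε/2))^{2/3}. -/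
open MeasureTheory Finset

structure GoodM (ν : Measure ℝ) : Prop where
  prob : IsProbabilityMeasure ν
  bd : ∀ᵐ x ∂ν, x ∈ Set.Icc (-1 : ℝ) 1
  mean : ∫ x, x ∂ν = 0

theorem good_int_one {ν : Measure ℝ} (hp : IsProbabilityMeasure ν)
    (h : ∀ᵐ x ∂ν, x ∈ Set.Icc (-1 : ℝ) 1) {g : ℝ → ℝ} (hg : Continuous g) :
    Integrable g ν := by
  have := hg.continuousOn.integrableOn_compact (μ := ν) (isCompact_Icc (a := (-1:ℝ)) (b := 1))
  rwa [IntegrableOn, Measure.restrict_eq_self_of_ae_mem h] at this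

theorem good_unif (s : Finset ℝ) (hs : s.Nonempty) (h1 : ∀ x ∈ s, x ∈ Set.Icc (-1 : ℝ) 1)
    (h0 : ∑ x ∈ s, x = 0) : GoodM (PMF.uniformOfFinset s hs).toMeasure := by
  have hp : IsProbabilityMeasure (PMF.uniformOfFinset s hs).toMeasure := inferInstance
  have hb : ∀ᵐ x ∂(PMF.uniformOfFinset s hs).toMeasure, x ∈ Set.Icc (-1 : ℝ) 1 := by
    rw [ae_iff]
    have hm : MeasurableSet {a : ℝ | ¬ a ∈ Set.Icc (-1 : ℝ) 1} := measurableSet_Icc.compl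
    rw [PMF.toMeasure_apply_eq_zero_iff _ hm, PMF.support_uniformOfFinset, Set.disjoint_left]
    intro a ha hb
    exact hb (h1 a ha)
  refine ⟨hp, hb, ?_⟩
  rw [PMF.integral_eq_tsum _ (fun x : ℝ => x) (good_int_one hp hb continuous_id), tsum_eq_sum (s := s)]
  · have : ∀ a ∈ s, ((PMF.uniformOfFinset s hs) a).toReal • a = ((s.card : ℝ)⁻¹) * a := by
      intro a ha
      simp [PMF.uniformOfFinset_apply, ha]
    rw [Finset.sum_congr rfl this, ← Finset.mul_sum, h0, mul_zero]
  · intro a ha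
    simp [PMF.uniformOfFinset_apply, ha]

theorem good_unif3 : GoodM unif3 := by
  apply good_unif
  · intro x hx
    simp only [Finset.mem_insert, Finset.mem_singleton] at hx
    rcases hx with rfl | rfl | rfl <;> norm_num
  · norm_num

theorem good_unif2 : GoodM unif2 := by
  apply good_unif
  · intro x hx
    simp only [Finset.mem_insert, Finset.mem_singleton] at hx
    rcases hx with rfl | rfl <;> norm_num
  · norm_num

theorem good_dirac : GoodM (Measure.dirac 0) := by
  refine ⟨inferInstance, ?_, ?_⟩
  · exact (ae_dirac_iff (p := fun x => x ∈ Set.Icc (-1 : ℝ) 1) measurableSet_Icc).2 (by norm_num)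
  · simp

theorem good_int_pi {d : ℕ} {ν : Fin d → Measure ℝ} (h : ∀ i, GoodM (ν i))
    {g : (Fin d → ℝ) → ℝ} (hg : Continuous g) : Integrable g (Measure.pi ν) := by
  haveI := fun i => (h i).prob
  have hb : ∀ᵐ x ∂(Measure.pi ν), x ∈ Set.Icc (fun _ => (-1 : ℝ)) (fun _ : Fin d => (1:ℝ)) := by
    have : ∀ᵐ x ∂(Measure.pi ν), ∀ i, x i ∈ Set.Icc (-1 : ℝ) 1 := by
      rw [ae_all_iff]
      intro i
      exact (Measure.quasiMeasurePreserving_eval ν i).ae (h i).bd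
    filter_upwards [this] with x hx
    exact ⟨fun i => (hx i).1, fun i => (hx i).2⟩
  have := hg.continuousOn.integrableOn_compact (μ := Measure.pi ν)
    (isCompact_Icc (a := (fun _ => (-1 : ℝ))) (b := (fun _ : Fin d => (1:ℝ))))
  rwa [IntegrableOn, Measure.restrict_eq_self_of_ae_mem hb] at this

theorem good_second {d : ℕ} {ν : Fin d → Measure ℝ} (h : ∀ i, GoodM (ν i)) (w : Fin d → ℝ) :
    ∫ x, (∑ j, w j * x j) ^ 2 ∂(Measure.pi ν) ≤ ∑ j, w j ^ 2 := by
  haveI := fun i => (h i).prob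
  have hL : ∀ i, MemLp (fun x : ℝ => w i * x) 2 (ν i) := by
    intro i
    rw [memLp_two_iff_integrable_sq (by fun_prop)]
    exact good_int_one (h i).prob (h i).bd (by fun_prop)
  have hv := ProbabilityTheory.variance_sum_pi hL
  have hmean : ∫ x, (∑ j, w j * x j) ∂(Measure.pi ν) = 0 := by
    rw [integral_finsetSum _ (fun i _ => good_int_pi h (by fun_prop))]
    apply Finset.sum_eq_zero
    intro j _
    have he : ∫ x : Fin d → ℝ, x j ∂(Measure.pi ν) = ∫ x, x ∂(ν j) :=
      integral_comp_eval (μ := ν) (i := j) (f := fun x : ℝ => x) (by fun_prop)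
    rw [integral_const_mul, he, (h j).mean, mul_zero]
  have e : (∑ i, fun ω : Fin d → ℝ => w i * ω i) = fun x => ∑ j, w j * x j := by
    ext x; simp
  have hm : Measurable (fun x : Fin d → ℝ => ∑ j, w j * x j) := by fun_prop
  rw [e, ProbabilityTheory.variance_of_integral_eq_zero hm.aemeasurable hmean] at hv
  rw [hv]
  apply Finset.sum_le_sum
  intro j _
  rw [ProbabilityTheory.variance_of_integral_eq_zero (by fun_prop)
    (by rw [integral_const_mul, (h j).mean, mul_zero])]
  calc ∫ x, (w j * x) ^ 2 ∂(ν j) ≤ ∫ x, w j ^ 2 ∂(ν j) := by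
        apply integral_mono_ae
        · exact good_int_one (h j).prob (h j).bd (by fun_prop)
        · exact integrable_const _
        · filter_upwards [(h j).bd] with x hx
          have : x ^ 2 ≤ 1 := by nlinarith [hx.1, hx.2]
          rw [mul_pow]
          nlinarith [sq_nonneg (w j)]
    _ = w j ^ 2 := by simp

theorem good_qnet {d m : ℕ} {ν : Fin d → Measure ℝ} (h : ∀ i, GoodM (ν i))
    (θ : Fin m → ℝ) (φ : Matrix (Fin d) (Fin m) ℝ) :
    ∫ x, qnet θ φ x ∂(Measure.pi ν) ≤ ∑ i, |θ i| * ∑ j, φ j i ^ 2 := by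
  unfold qnet
  rw [integral_finsetSum _ (fun i _ => good_int_pi h (by fun_prop))]
  apply Finset.sum_le_sum
  intro i _
  rw [integral_const_mul]
  have h2 := good_second h (fun j => φ j i)
  have h0 : 0 ≤ ∫ x, (∑ j, φ j i * x j) ^ 2 ∂(Measure.pi ν) :=
    integral_nonneg fun x => sq_nonneg _
  exact mul_le_mul (le_abs_self _) h2 h0 (abs_nonneg _)

theorem good_branch0 (d : ℕ) (i : Fin d) :
    GoodM (if (i : ℕ) < 1 then Measure.dirac (0 : ℝ) else unif3) := by
  split_ifs
  exacts [good_dirac, good_unif3]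

theorem good_branch1 (d : ℕ) (i : Fin d) :
    GoodM (if (i : ℕ) < 1 then unif2 else unif3) := by
  split_ifs
  exacts [good_unif2, good_unif3]

theorem loss_lower {d m : ℕ} (θ : Fin m → ℝ) (φ : Matrix (Fin d) (Fin m) ℝ) :
    (2/3) * (∫ x, qnet θ φ x ∂(srcBranch1 d 1) - 1) ^ 2 ≤ popLoss (targetMeasure d) θ φ := by
  have hc := qnet_cont θ φ
  have i0 : ∀ {g : (Fin d → ℝ) → ℝ}, Continuous g → Integrable g (srcBranch0 d 1) :=
    fun hg => good_int_pi (good_branch0 d) hg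
  have i1 : ∀ {g : (Fin d → ℝ) → ℝ}, Continuous g → Integrable g (srcBranch1 d 1) :=
    fun hg => good_int_pi (good_branch1 d) hg
  have hp : IsProbabilityMeasure (srcBranch1 d 1) := by
    haveI := fun i => (good_branch1 d i).prob
    unfold srcBranch1
    infer_instance
  have hF : Continuous (fun p : (Fin d → ℝ) × ℝ => (qnet θ φ p.1 - p.2) ^ 2) := by fun_prop
  have m0 : Measurable (fun x : Fin d → ℝ => (x, (0:ℝ))) := by fun_prop
  have m1 : Measurable (fun x : Fin d → ℝ => (x, (1:ℝ))) := by fun_prop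
  unfold popLoss targetMeasure sourceMeasure
  rw [integral_add_measure, integral_smul_measure, integral_smul_measure,
    integral_map m0.aemeasurable hF.aestronglyMeasurable,
    integral_map m1.aemeasurable hF.aestronglyMeasurable]
  · have hL : MemLp (fun x => qnet θ φ x - 1) 2 (srcBranch1 d 1) := by
      rw [memLp_two_iff_integrable_sq (by fun_prop)]
      exact i1 (by fun_prop)
    have hv := ProbabilityTheory.variance_eq_sub hL
    have hv0 := ProbabilityTheory.variance_nonneg (fun x => qnet θ φ x - 1) (srcBranch1 d 1)
    rw [hv, integral_sub (i1 hc) (integrable_const _)] at hv0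
    simp only [integral_const, probReal_univ, one_smul, Pi.pow_apply] at hv0
    have h0 : 0 ≤ ∫ x, (qnet θ φ x - 0) ^ 2 ∂(srcBranch0 d 1) :=
      integral_nonneg fun x => sq_nonneg _
    have t1 : (1/3 : ENNReal).toReal = 1/3 := by simp
    have t2 : (2/3 : ENNReal).toReal = 2/3 := by simp
    rw [t1, t2, smul_eq_mul, smul_eq_mul]
    simp only at *
    linarith
  · refine Integrable.smul_measure ?_ (by simp [ENNReal.div_eq_top])
    rw [integrable_map_measure hF.aestronglyMeasurable m0.aemeasurable]
    exact i0 (by simp only [Function.comp_def]; fun_prop)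
  · refine Integrable.smul_measure ?_ (by simp [ENNReal.div_eq_top])
    rw [integrable_map_measure hF.aestronglyMeasurable m1.aemeasurable]
    exact i1 (by simp only [Function.comp_def]; fun_prop)

/-- The norm lower bound for target-accurate solutions: if the target population loss of
`(θ_t, φ)` is at most `ε ≤ 2/3`, then `‖θ_t‖² + ½‖φ‖_F² ≥ (3/2^{4/3})(1 - √(3ε/2))^{2/3}`. -/
theorem target_norm_lower_bound (d m : ℕ) (hd : 1 ≤ d) (ε : ℝ) (hε0 : 0 ≤ ε)
    (hε1 : ε ≤ 2 / 3) (θt : Fin m → ℝ) (φ : Matrix (Fin d) (Fin m) ℝ)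
    (hloss : popLoss (targetMeasure d) θt φ ≤ ε) :
    (3 / (2 : ℝ) ^ ((4 : ℝ) / 3)) * (1 - Real.sqrt (3 * ε / 2)) ^ ((2 : ℝ) / 3)
      ≤ normSq θt + (1 / 2) * frobSq φ := by
  have hl := (loss_lower θt φ).trans hloss
  have hq : ∫ x, qnet θt φ x ∂(srcBranch1 d 1) ≤ _ := good_qnet (good_branch1 d) θt φ
  set M := ∫ x, qnet θt φ x ∂(srcBranch1 d 1)
  set A := ∑ i, |θt i| * ∑ j, φ j i ^ 2 with hA
  have hM : 1 - Real.sqrt (3 * ε / 2) ≤ M := by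
    have : |M - 1| ≤ Real.sqrt (3 * ε / 2) := Real.abs_le_sqrt (by linarith)
    linarith [(abs_le.mp this).1]
  have hc0 : 0 ≤ 1 - Real.sqrt (3 * ε / 2) := by
    have : Real.sqrt (3 * ε / 2) ≤ 1 := Real.sqrt_le_one.mpr (by linarith)
    linarith
  set c := 1 - Real.sqrt (3 * ε / 2)
  have hcA : c ≤ A := hM.trans hq
  have hT : 0 ≤ normSq θt := Finset.sum_nonneg fun i _ => sq_nonneg _
  have hF : 0 ≤ frobSq φ := Finset.sum_nonneg fun i _ => Finset.sum_nonneg fun j _ => sq_nonneg _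
  have hFe : frobSq φ = ∑ i, ∑ j, φ j i ^ 2 := Finset.sum_comm
  have hA2 : A ^ 2 ≤ normSq θt * frobSq φ ^ 2 := by
    calc A ^ 2 ≤ (∑ i, |θt i| ^ 2) * ∑ i, (∑ j, φ j i ^ 2) ^ 2 :=
          Finset.sum_mul_sq_le_sq_mul_sq _ _ _
      _ ≤ normSq θt * frobSq φ ^ 2 := by
          simp only [sq_abs]
          rw [hFe]
          refine mul_le_mul_of_nonneg_left ?_ hT
          exact Finset.sum_sq_le_sq_sum_of_nonneg
            fun i _ => Finset.sum_nonneg fun j _ => sq_nonneg _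
  have hc2 : c ^ 2 ≤ normSq θt * frobSq φ ^ 2 := (pow_le_pow_left₀ hc0 hcA 2).trans hA2
  have hS : 0 ≤ normSq θt + (1 / 2) * frobSq φ := by positivity
  refine le_of_pow_le_pow_left₀ (n := 3) (by norm_num) hS ?_
  have e1 : (c ^ ((2 : ℝ) / 3)) ^ 3 = c ^ 2 := by
    rw [← Real.rpow_natCast, ← Real.rpow_mul hc0, ← Real.rpow_natCast]; norm_num
  have e2 : ((2 : ℝ) ^ ((4 : ℝ) / 3)) ^ 3 = 16 := by
    rw [← Real.rpow_natCast, ← Real.rpow_mul (by norm_num)]; norm_num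
  rw [mul_pow, div_pow, e1, e2]
  generalize normSq θt = T at *
  generalize frobSq φ = F at *
  have key : 0 ≤ (T + 1 / 2 * F) ^ 3 - 27 / 16 * (T * F ^ 2) := by
    have : (T + 1 / 2 * F) ^ 3 - 27 / 16 * (T * F ^ 2) = (T - F / 4) ^ 2 * (T + 2 * F) := by ring
    rw [this]; positivity
  linarith
end

section
/- Let λ > 0 and β > 0, and define g: ℝ → ℝ by g(μ) = (3λ/2^{2/3})·|μ|^{2/3} + β·(μ − 1)^2. Then g attains its global minimum on ℝ, and every global minimizer μ* satisfies 0 ≤ μ* ≤ 1. Moreover, if 3λ/2^{2/3} < β, then every global minimizer satisfies 0 < μ* ≤ 1; in particular, for β = 2/3 and 0 < λ < 0.1 every global minimizer of g is strictly positive. -/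
/-- Properties of the scalar auxiliary function
`g(μ) = (3λ/2^{2/3})|μ|^{2/3} + β(μ-1)²`: it attains its global minimum, every global
minimizer lies in `[0, 1]`, and if `3λ/2^{2/3} < β` (in particular if `β = 2/3` and
`λ < 0.1`) every global minimizer is strictly positive. -/
theorem aux_function_minimizers (lam β : ℝ) (hlam : 0 < lam) (hβ : 0 < β) :
    let g : ℝ → ℝ := fun μ =>
      (3 * lam / (2 : ℝ) ^ ((2 : ℝ) / 3)) * |μ| ^ ((2 : ℝ) / 3) + β * (μ - 1) ^ 2
    (∃ μ0 : ℝ, ∀ μ : ℝ, g μ0 ≤ g μ)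
    ∧ (∀ μ0 : ℝ, (∀ μ : ℝ, g μ0 ≤ g μ) → 0 ≤ μ0 ∧ μ0 ≤ 1)
    ∧ (3 * lam / (2 : ℝ) ^ ((2 : ℝ) / 3) < β →
        ∀ μ0 : ℝ, (∀ μ : ℝ, g μ0 ≤ g μ) → 0 < μ0)
    ∧ (β = 2 / 3 → lam < 0.1 →
        ∀ μ0 : ℝ, (∀ μ : ℝ, g μ0 ≤ g μ) → 0 < μ0) := by
  have h2 : (1 : ℝ) ≤ (2 : ℝ) ^ ((2 : ℝ) / 3) :=
    Real.one_le_rpow (by norm_num) (by norm_num)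
  have hc : 0 < 3 * lam / (2 : ℝ) ^ ((2 : ℝ) / 3) := by positivity
  have hc3 : 3 * lam / (2 : ℝ) ^ ((2 : ℝ) / 3) ≤ 3 * lam :=
    div_le_self (by positivity) h2
  generalize 3 * lam / (2 : ℝ) ^ ((2 : ℝ) / 3) = c at hc hc3 ⊢
  intro g
  have g0 : g 0 = β := by
    simp only [g]
    rw [abs_zero, Real.zero_rpow (by norm_num)]; ring
  have g1 : g 1 = c := by
    simp only [g]
    rw [abs_one, Real.one_rpow]; ring
  have hneg : ∀ μ : ℝ, μ < 0 → g 0 < g μ := by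
    intro μ hμ
    rw [g0]
    have h : 0 ≤ c * |μ| ^ ((2 : ℝ) / 3) := by positivity
    simp only [g]
    nlinarith [mul_pos hβ (neg_pos.2 hμ), mul_nonneg hβ.le (sq_nonneg μ)]
  have hbig : ∀ μ : ℝ, 1 < μ → g 1 < g μ := by
    intro μ hμ
    rw [g1]
    have h : 1 ≤ |μ| ^ ((2 : ℝ) / 3) :=
      Real.one_le_rpow (hμ.le.trans (le_abs_self μ)) (by norm_num)
    have h' : 0 < β * (μ - 1) ^ 2 := mul_pos hβ (pow_pos (by linarith) 2)
    simp only [g]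
    nlinarith
  have hrange : ∀ μ0 : ℝ, (∀ μ : ℝ, g μ0 ≤ g μ) → 0 ≤ μ0 ∧ μ0 ≤ 1 := by
    intro μ0 h
    exact ⟨le_of_not_gt fun hn => absurd (h 0) (not_le.2 (hneg _ hn)),
      le_of_not_gt fun hn => absurd (h 1) (not_le.2 (hbig _ hn))⟩
  have hpos : c < β → ∀ μ0 : ℝ, (∀ μ : ℝ, g μ0 ≤ g μ) → 0 < μ0 := by
    intro hcb μ0 h
    rcases (hrange μ0 h).1.lt_or_eq with h0 | h0
    · exact h0
    · have := h 1
      rw [← h0, g0, g1] at this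
      linarith
  refine ⟨?_, hrange, hpos, ?_⟩
  · have hcont : Continuous g := by
      have : Continuous fun μ : ℝ => |μ| ^ ((2 : ℝ) / 3) :=
        continuous_abs.rpow_const fun _ => Or.inr (by norm_num)
      simp only [g]
      fun_prop
    obtain ⟨m, _, hm⟩ := (isCompact_Icc (a := (0 : ℝ)) (b := 1)).exists_isMinOn
      ⟨0, by simp⟩ hcont.continuousOn
    have hm' : ∀ x ∈ Set.Icc (0 : ℝ) 1, g m ≤ g x := fun x hx => hm hx
    refine ⟨m, fun μ => ?_⟩
    rcases lt_or_ge μ 0 with h | h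
    · exact (hm' 0 (by simp)).trans (hneg μ h).le
    rcases lt_or_ge 1 μ with h1 | h1
    · exact (hm' 1 (by simp)).trans (hbig μ h1).le
    · exact hm' μ ⟨h, h1⟩
  · intro hb hl
    norm_num at hl
    exact hpos (by linarith)
end
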